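/- Let a, b > 0, ν ∈ [0,1] and N ∈ ℕ with N ≥ 2. Then (a^ν b^{1−ν})² + s_1(ν)² (a−b)² + ∑_{j=2}^{N} s_j(ν) ( (b^{2^{j−1}−k_j(ν)} a^{k_j(ν)})^{1/2^{j−1}} − (a^{k_j(ν)+1} b^{2^{j−1}−k_j(ν)−1})^{1/2^{j−1}} )² ≤ (ν a + (1−ν) b)². -/

import Mathlib

open Real Finset

noncomputable def kj (j : ℕ) (ν : ℝ) : ℤ := ⌊(2:ℝ)^(j-1) * ν⌋

noncomputable def rj (j : ℕ) (ν : ℝ) : ℤ := ⌊(2:ℝ)^j * ν⌋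

noncomputable def sj (j : ℕ) (ν : ℝ) : ℝ :=
  (-1:ℝ)^(rj j ν) * (2:ℝ)^(j-1) * ν
    + (-1:ℝ)^(rj j ν + 1) * (⌊((rj j ν : ℝ) + 1)/2⌋ : ℤ)

noncomputable def SS (N : ℕ) (ν a b : ℝ) : ℝ :=
  ∑ j ∈ Finset.Icc 1 N, sj j ν *
    ((b ^ ((2:ℝ)^(j-1) - (kj j ν : ℝ)) * a ^ ((kj j ν : ℝ))) ^ ((1:ℝ)/2^j)
      - (a ^ ((kj j ν : ℝ) + 1) * b ^ ((2:ℝ)^(j-1) - (kj j ν : ℝ) - 1)) ^ ((1:ℝ)/2^j))^2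

/-- On a dyadic cell whose left half contains `2^n ν`, `sj` is the fractional part. -/
lemma sj_of_left (n : ℕ) (ν : ℝ) (h : rj (n + 1) ν = 2 * kj (n + 1) ν) :
    sj (n + 1) ν = 2 ^ n * ν - kj (n + 1) ν := by
  have hfl : ⌊(((2 * kj (n + 1) ν : ℤ) : ℝ) + 1) / 2⌋ = kj (n + 1) ν := by
    rw [Int.floor_eq_iff]
    push_cast
    constructor <;> linarith
  have he : (-1 : ℝ) ^ (2 * kj (n + 1) ν) = 1 := (even_two_mul _).neg_one_zpow
  rw [sj, h, hfl, zpow_add₀ (by norm_num), he, Nat.add_sub_cancel]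
  norm_num
  ring

/-- On a dyadic cell whose right half contains `2^n ν`, `sj` is the distance to the right end. -/
lemma sj_of_right (n : ℕ) (ν : ℝ) (h : rj (n + 1) ν = 2 * kj (n + 1) ν + 1) :
    sj (n + 1) ν = kj (n + 1) ν + 1 - 2 ^ n * ν := by
  have hfl : ⌊(((2 * kj (n + 1) ν + 1 : ℤ) : ℝ) + 1) / 2⌋ = kj (n + 1) ν + 1 := by
    rw [Int.floor_eq_iff]
    push_cast
    constructor <;> linarith
  have he : (-1 : ℝ) ^ (2 * kj (n + 1) ν) = 1 := (even_two_mul _).neg_one_zpow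
  have hne : (-1 : ℝ) ≠ 0 := by norm_num
  rw [sj, h, hfl, Nat.add_sub_cancel]
  simp only [zpow_add_one₀ hne, he]
  push_cast
  ring

lemma rj_eq_or (n : ℕ) (ν : ℝ) :
    rj (n + 1) ν = 2 * kj (n + 1) ν ∨ rj (n + 1) ν = 2 * kj (n + 1) ν + 1 := by
  have hk := Int.floor_le ((2 : ℝ) ^ n * ν)
  have hk' := Int.lt_floor_add_one ((2 : ℝ) ^ n * ν)
  simp only [rj, kj, Nat.add_sub_cancel, Int.floor_eq_iff, pow_succ]
  push_cast
  rcases lt_or_ge ((2 : ℝ) ^ n * ν) (⌊(2 : ℝ) ^ n * ν⌋ + 1 / 2) with h | h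
  · left; constructor <;> linarith
  · right; constructor <;> linarith

/-- The piecewise linear interpolation of `f` on the grid of mesh `2^(-n)`. -/
noncomputable def dyadicInterp (f : ℝ → ℝ) (n : ℕ) (ν : ℝ) : ℝ :=
  (1 - (2 ^ n * ν - kj (n + 1) ν)) * f (kj (n + 1) ν / 2 ^ n)
    + (2 ^ n * ν - kj (n + 1) ν) * f ((kj (n + 1) ν + 1) / 2 ^ n)

lemma dyadicInterp_eq_add_succ (f : ℝ → ℝ) (n : ℕ) (ν : ℝ) :
    dyadicInterp f n ν = dyadicInterp f (n + 1) ν + sj (n + 1) ν *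
      (f (kj (n + 1) ν / 2 ^ n) + f ((kj (n + 1) ν + 1) / 2 ^ n)
        - 2 * f ((2 * kj (n + 1) ν + 1) / 2 ^ (n + 1))) := by
  have hkr : kj (n + 1 + 1) ν = rj (n + 1) ν := rfl
  have hM : (2 : ℝ) ^ n ≠ 0 := by positivity
  rcases rj_eq_or n ν with h | h
  · have e : (2 * (kj (n + 1) ν : ℝ)) / 2 ^ (n + 1) = kj (n + 1) ν / 2 ^ n := by
      rw [pow_succ]; field_simp
    rw [sj_of_left n ν h, dyadicInterp, dyadicInterp, hkr, h]
    push_cast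
    rw [e, pow_succ]
    ring
  · have e : (2 * (kj (n + 1) ν : ℝ) + 1 + 1) / 2 ^ (n + 1) = (kj (n + 1) ν + 1) / 2 ^ n := by
      rw [pow_succ]; field_simp; ring
    rw [sj_of_right n ν h, dyadicInterp, dyadicInterp, hkr, h]
    push_cast
    rw [e, pow_succ]
    ring

lemma ConvexOn.le_dyadicInterp {f : ℝ → ℝ} (hf : ConvexOn ℝ Set.univ f) (n : ℕ) (ν : ℝ) :
    f ν ≤ dyadicInterp f n ν := by
  have hk : (kj (n + 1) ν : ℝ) ≤ 2 ^ n * ν := Int.floor_le _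
  have hk' : 2 ^ n * ν < kj (n + 1) ν + 1 := Int.lt_floor_add_one _
  have hM : (2 : ℝ) ^ n ≠ 0 := by positivity
  have h := hf.2 (Set.mem_univ ((kj (n + 1) ν : ℝ) / 2 ^ n))
    (Set.mem_univ (((kj (n + 1) ν : ℝ) + 1) / 2 ^ n))
    (show 0 ≤ 1 - (2 ^ n * ν - kj (n + 1) ν) by linarith)
    (show 0 ≤ 2 ^ n * ν - kj (n + 1) ν by linarith) (by ring)
  simp only [smul_eq_mul] at h
  refine le_of_eq_of_le (congrArg f ?_) h
  field_simp
  ring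

/-- The squared weighted geometric mean of `a` and `b`, as a function of the weight. -/
noncomputable def sqGeomMean (a b t : ℝ) : ℝ := (a ^ t * b ^ (1 - t)) ^ 2

lemma rpow_mul_rpow_eq_exp {a b : ℝ} (ha : 0 < a) (hb : 0 < b) (s t : ℝ) :
    a ^ s * b ^ t = exp (log a * s + log b * t) := by
  rw [rpow_def_of_pos ha, rpow_def_of_pos hb, exp_add]

lemma convexOn_sqGeomMean {a b : ℝ} (ha : 0 < a) (hb : 0 < b) :
    ConvexOn ℝ Set.univ (sqGeomMean a b) := by
  refine ⟨convex_univ, fun x _ y _ u v hu hv huv => ?_⟩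
  have h := convexOn_exp.2 (Set.mem_univ (2 * (log a * x + log b * (1 - x))))
    (Set.mem_univ (2 * (log a * y + log b * (1 - y)))) hu hv huv
  simp only [smul_eq_mul, sqGeomMean, rpow_mul_rpow_eq_exp ha hb, ← exp_nat_mul] at h ⊢
  push_cast
  convert h using 2
  obtain rfl : v = 1 - u := by linarith
  ring

lemma sq_sub_eq_sqGeomMean {a b : ℝ} (ha : 0 < a) (hb : 0 < b) {M : ℝ} (hM : M ≠ 0) (k : ℝ) :
    ((b ^ (M - k) * a ^ k) ^ (1 / M) - (a ^ (k + 1) * b ^ (M - k - 1)) ^ (1 / M)) ^ 2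
      = sqGeomMean a b (k / M) + sqGeomMean a b ((k + 1) / M)
        - 2 * sqGeomMean a b ((2 * k + 1) / (M * 2)) := by
  simp only [sqGeomMean, rpow_mul_rpow_eq_exp ha hb, rpow_mul_rpow_eq_exp hb ha, ← exp_mul]
  have e₁ : (log b * (M - k) + log a * k) * (1 / M)
      = log a * (k / M) + log b * (1 - k / M) := by field_simp; ring
  have e₂ : (log a * (k + 1) + log b * (M - k - 1)) * (1 / M)
      = log a * ((k + 1) / M) + log b * (1 - (k + 1) / M) := by field_simp; ring
  have e₃ : exp (log a * ((2 * k + 1) / (M * 2)) + log b * (1 - (2 * k + 1) / (M * 2))) ^ 2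
      = exp (log a * (k / M) + log b * (1 - k / M))
        * exp (log a * ((k + 1) / M) + log b * (1 - (k + 1) / M)) := by
    rw [← exp_nat_mul, ← exp_add]
    congr 1
    field_simp
    push_cast
    ring
  rw [e₁, e₂, e₃]
  ring

lemma sum_add_dyadicInterp {a b : ℝ} (ha : 0 < a) (hb : 0 < b) (ν : ℝ) {N : ℕ} (hN : 1 ≤ N) :
    ∑ j ∈ Finset.Icc 2 N, sj j ν *
        ((b ^ ((2:ℝ)^(j-1) - (kj j ν : ℝ)) * a ^ ((kj j ν : ℝ))) ^ ((1:ℝ)/2^(j-1))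
          - (a ^ ((kj j ν : ℝ) + 1) * b ^ ((2:ℝ)^(j-1) - (kj j ν : ℝ) - 1)) ^ ((1:ℝ)/2^(j-1)))^2
      + dyadicInterp (sqGeomMean a b) N ν = dyadicInterp (sqGeomMean a b) 1 ν := by
  induction N, hN using Nat.le_induction with
  | base => simp
  | succ n hn ih =>
    rw [Finset.sum_Icc_succ_top (by omega), ← ih, dyadicInterp_eq_add_succ _ n, Nat.add_sub_cancel,
      sq_sub_eq_sqGeomMean ha hb (by positivity), pow_succ]
    ring

lemma dyadicInterp_one_add {a b ν : ℝ} (ha : 0 < a) (hb : 0 < b) (h0 : 0 ≤ ν) (h1 : ν ≤ 1) :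
    dyadicInterp (sqGeomMean a b) 1 ν + sj 1 ν ^ 2 * (a - b) ^ 2 = (ν * a + (1 - ν) * b) ^ 2 := by
  have hL := dyadicInterp_eq_add_succ (sqGeomMean a b) 0 ν
  have hd := sq_sub_eq_sqGeomMean ha hb one_ne_zero (kj (0 + 1) ν)
  rw [pow_zero, zero_add, pow_one] at hL
  rw [one_mul, zero_add] at hd
  rw [← hd, dyadicInterp, zero_add] at hL
  have hf0 : sqGeomMean a b 0 = b ^ 2 := by simp [sqGeomMean]
  have hf1 : sqGeomMean a b 1 = a ^ 2 := by simp [sqGeomMean]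
  rcases h1.eq_or_lt with rfl | h1
  · have hk : kj 1 1 = 1 := by simp [kj]
    have hr : rj 1 1 = 2 := by simp [rj]
    have hs := sj_of_left 0 1 (by rw [zero_add, hk, hr]; norm_num)
    rw [zero_add, hk] at hs
    norm_num at hs
    rw [hs, hk] at hL
    rw [hs]
    norm_num [hf1] at hL ⊢
    linarith
  · have hk : kj 1 ν = 0 := by
      rw [kj, Int.floor_eq_iff]
      norm_num
      exact ⟨h0, h1⟩
    have hs : sj 1 ν = ν ∨ sj 1 ν = 1 - ν := by
      rcases rj_eq_or 0 ν with h | h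
      · left; simpa [hk] using sj_of_left 0 ν h
      · right; simpa [hk] using sj_of_right 0 ν h
    rw [hk] at hL
    norm_num [hf0, hf1] at hL
    rcases hs with hs | hs <;> rw [hs] at hL ⊢ <;> linear_combination -hL

theorem stmt6 (a b ν : ℝ) (ha : 0 < a) (hb : 0 < b) (h0 : 0 ≤ ν) (h1 : ν ≤ 1)
    (N : ℕ) (hN : 2 ≤ N) :
    (a ^ ν * b ^ (1 - ν))^2 + (sj 1 ν)^2 * (a - b)^2
      + ∑ j ∈ Finset.Icc 2 N, sj j ν *
          ((b ^ ((2:ℝ)^(j-1) - (kj j ν : ℝ)) * a ^ ((kj j ν : ℝ))) ^ ((1:ℝ)/2^(j-1))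
            - (a ^ ((kj j ν : ℝ) + 1) * b ^ ((2:ℝ)^(j-1) - (kj j ν : ℝ) - 1)) ^ ((1:ℝ)/2^(j-1)))^2
      ≤ (ν * a + (1 - ν) * b)^2 := by
  have hs := sum_add_dyadicInterp ha hb ν (show 1 ≤ N by omega)
  have hc := (convexOn_sqGeomMean ha hb).le_dyadicInterp N ν
  rw [← dyadicInterp_one_add ha hb h0 h1, ← hs]
  rw [sqGeomMean] at hc
  linarith
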